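/- arXiv:2208.01361 — 3 statements merged into one kernel-verified Lean document; each statement's English description precedes it below -/
import Mathlib

section
/- Let e₀ > 0 and let F : ℝ × ℝ × ℝ × ℝ × ℝ → ℝ, written F(r,θ,y,ε₁,ε₂), be C³ and 1-periodic in θ. Assume F(0,θ,0,ε₁,0) = 0 and ∂F/∂r(0,θ,0,ε₁,0) = 0 for all θ ∈ ℝ and all ε₁ ∈ [0,e₀], and that ∂²F/∂r²(0,θ,0,0,0) > 0 and ∂F/∂y(0,θ,0,0,0) < 0 for all θ ∈ ℝ. Define a(θ) := −∂F/∂y(0,θ,0,0,0) and b(θ) := (1/2)·∂²F/∂r²(0,θ,0,0,0). Then a and b are positive, 1-periodic and C¹, and there exist δ > 0 and C > 0 such that for all |r| ≤ δ, |y| ≤ δ, θ ∈ ℝ, ε₁ ∈ [0,δ], ε₂ ∈ [0,δ]: |F(r,θ,y,ε₁,ε₂) − (−a(θ)·y + b(θ)·r²)| ≤ C·(|r|³ + y² + |r|·|y| + ε₁·r² + ε₁·|y| + ε₂). -/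
/-- The coefficient `a(θ) = −∂F/∂y(0,θ,0,0,0)`. -/
noncomputable def aCoef (F : ℝ × ℝ × ℝ × ℝ × ℝ → ℝ) (θ : ℝ) : ℝ :=
  -(deriv (fun y => F (0, θ, y, 0, 0)) 0)

/-- The coefficient `b(θ) = (1/2)·∂²F/∂r²(0,θ,0,0,0)`. -/
noncomputable def bCoef (F : ℝ × ℝ × ℝ × ℝ × ℝ → ℝ) (θ : ℝ) : ℝ :=
  (1/2) * iteratedDeriv 2 (fun r => F (r, θ, 0, 0, 0)) 0

/-- A function whose derivative is bounded by `M` on `[-|x|, |x|]` varies by at most `M * |x|`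
between `0` and `x`. -/
theorem abs_sub_apply_zero_le_of_abs_deriv_le {g g' : ℝ → ℝ} {x M : ℝ}
    (hg : ∀ t, HasDerivAt g (g' t) t) (hM : ∀ t, |t| ≤ |x| → |g' t| ≤ M) :
    |g x - g 0| ≤ M * |x| := by
  have h := (convex_closedBall (0 : ℝ) |x|).norm_image_sub_le_of_norm_hasDerivWithin_le
    (f := g) (f' := g') (C := M) (x := 0) (y := x) (fun t _ => (hg t).hasDerivWithinAt)
    (fun t ht => hM t (by simpa using ht)) (by simp) (by simp)
  simpa using h

theorem ContDiff.exists_abs_sub_le_mul_norm_sub {E : Type*} [NormedAddCommGroup E]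
    [NormedSpace ℝ E] [ProperSpace E] {G : E → ℝ} (hG : ContDiff ℝ 1 G) (R : ℝ) :
    ∃ L : ℝ, 0 ≤ L ∧ ∀ p q : E, ‖p‖ ≤ R → ‖q‖ ≤ R → |G p - G q| ≤ L * ‖p - q‖ := by
  obtain ⟨K, hK⟩ := (hG.locallyLipschitz.locallyLipschitzOn
    (s := Metric.closedBall (0 : E) R)).exists_lipschitzOnWith_of_compact
    (isCompact_closedBall 0 R)
  refine ⟨K, K.2, fun p q hp hq => ?_⟩
  simpa [dist_eq_norm] using hK.dist_le_mul p (by simpa using hp) q (by simpa using hq)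

section PartialDerivatives

variable {G : ℝ × ℝ × ℝ × ℝ × ℝ → ℝ}

theorem hasDerivAt_fst_of_differentiable (hG : Differentiable ℝ G) (θ y ε₁ ε₂ t : ℝ) :
    HasDerivAt (fun r => G (r, θ, y, ε₁, ε₂)) (fderiv ℝ G (t, θ, y, ε₁, ε₂) (1, 0, 0, 0, 0)) t :=
  (hG (t, θ, y, ε₁, ε₂)).hasFDerivAt.comp_hasDerivAt t
    ((hasDerivAt_id t).prodMk (hasDerivAt_const t (θ, y, ε₁, ε₂)))

theorem hasDerivAt_third_of_differentiable (hG : Differentiable ℝ G) (r θ ε₁ ε₂ t : ℝ) :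
    HasDerivAt (fun y => G (r, θ, y, ε₁, ε₂)) (fderiv ℝ G (r, θ, t, ε₁, ε₂) (0, 0, 1, 0, 0)) t :=
  (hG (r, θ, t, ε₁, ε₂)).hasFDerivAt.comp_hasDerivAt t
    ((hasDerivAt_const t r).prodMk ((hasDerivAt_const t θ).prodMk
      ((hasDerivAt_id t).prodMk (hasDerivAt_const t (ε₁, ε₂)))))

theorem iteratedDeriv_two_fst_eq (hG : ContDiff ℝ 2 G) (θ y ε₁ ε₂ t : ℝ) :
    iteratedDeriv 2 (fun r => G (r, θ, y, ε₁, ε₂)) t =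
      fderiv ℝ (fun p => fderiv ℝ G p (1, 0, 0, 0, 0)) (t, θ, y, ε₁, ε₂) (1, 0, 0, 0, 0) := by
  have hG' : ContDiff ℝ 1 (fun p => fderiv ℝ G p (1, 0, 0, 0, 0)) :=
    (hG.fderiv_right (m := 1) (by norm_num)).clm_apply contDiff_const
  rw [iteratedDeriv_succ, iteratedDeriv_one,
    funext fun s => (hasDerivAt_fst_of_differentiable (hG.differentiable (by norm_num))
      θ y ε₁ ε₂ s).deriv]
  exact (hasDerivAt_fst_of_differentiable (hG'.differentiable (by norm_num)) θ y ε₁ ε₂ t).deriv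

end PartialDerivatives

theorem norm_quintuple_le {r θ y ε₁ ε₂ M : ℝ} (hr : |r| ≤ M) (hθ : |θ| ≤ M) (hy : |y| ≤ M)
    (hε₁ : |ε₁| ≤ M) (hε₂ : |ε₂| ≤ M) : ‖(r, θ, y, ε₁, ε₂)‖ ≤ M := by
  simp [Prod.norm_def, *]

/-- The normal form estimate with `θ` restricted to the unit interval. -/
theorem exists_remainder_bound_on_unit_interval {e₀ : ℝ} (he₀ : 0 < e₀)
    {F : ℝ × ℝ × ℝ × ℝ × ℝ → ℝ} (hF : ContDiff ℝ 3 F)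
    (h0 : ∀ θ : ℝ, ∀ ε₁ ∈ Set.Icc (0:ℝ) e₀, F (0, θ, 0, ε₁, 0) = 0)
    (h1 : ∀ θ : ℝ, ∀ ε₁ ∈ Set.Icc (0:ℝ) e₀, deriv (fun r => F (r, θ, 0, ε₁, 0)) 0 = 0) :
    ∃ δ > (0:ℝ), ∃ C > (0:ℝ), ∀ r y θ : ℝ, |θ| ≤ 1 →
      ∀ ε₁ ∈ Set.Icc (0:ℝ) δ, ∀ ε₂ ∈ Set.Icc (0:ℝ) δ, |r| ≤ δ → |y| ≤ δ →
      |F (r, θ, y, ε₁, ε₂) - (-(aCoef F θ) * y + bCoef F θ * r ^ 2)| ≤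
        C * (|r| ^ 3 + y ^ 2 + |r| * |y| + ε₁ * r ^ 2 + ε₁ * |y| + ε₂) := by
  have hFd : Differentiable ℝ F := hF.differentiable (by norm_num)
  have hDr : ContDiff ℝ 2 (fun p => fderiv ℝ F p (1, 0, 0, 0, 0)) :=
    (hF.fderiv_right (m := 2) (by norm_num)).clm_apply contDiff_const
  have hDy : ContDiff ℝ 2 (fun p => fderiv ℝ F p (0, 0, 1, 0, 0)) :=
    (hF.fderiv_right (m := 2) (by norm_num)).clm_apply contDiff_const
  have hDrr : ContDiff ℝ 1
      (fun p => fderiv ℝ (fun p => fderiv ℝ F p (1, 0, 0, 0, 0)) p (1, 0, 0, 0, 0)) :=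
    (hDr.fderiv_right (m := 1) (by norm_num)).clm_apply contDiff_const
  have ha (θ : ℝ) : aCoef F θ = -fderiv ℝ F (0, θ, 0, 0, 0) (0, 0, 1, 0, 0) := by
    rw [aCoef, (hasDerivAt_third_of_differentiable hFd 0 θ 0 0 0).deriv]
  have hb (θ : ℝ) : 2 * bCoef F θ = fderiv ℝ (fun p => fderiv ℝ F p (1, 0, 0, 0, 0))
      (0, θ, 0, 0, 0) (1, 0, 0, 0, 0) := by
    rw [bCoef, iteratedDeriv_two_fst_eq (hF.of_le (by norm_num))]
    ring
  obtain ⟨L₀, hL₀, hlip₀⟩ := (hF.of_le (by norm_num)).exists_abs_sub_le_mul_norm_sub 1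
  obtain ⟨L₁, hL₁, hlip₁⟩ := (hDy.of_le (by norm_num)).exists_abs_sub_le_mul_norm_sub 1
  obtain ⟨L₂, hL₂, hlip₂⟩ := hDrr.exists_abs_sub_le_mul_norm_sub 1
  refine ⟨min e₀ 1, by positivity, L₀ + L₁ + L₂ + 1, by positivity, ?_⟩
  intro r y θ hθ ε₁ hε₁ ε₂ hε₂ hr hy
  have hε₁e : ε₁ ∈ Set.Icc 0 e₀ := ⟨hε₁.1, hε₁.2.trans (min_le_left _ _)⟩
  have hr1 : |r| ≤ 1 := hr.trans (min_le_right _ _)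
  have hy1 : |y| ≤ 1 := hy.trans (min_le_right _ _)
  have hε₁0 := hε₁.1
  have hε₂0 := hε₂.1
  have hε₁1 : |ε₁| ≤ 1 := by rw [abs_of_nonneg hε₁0]; exact hε₁.2.trans (min_le_right _ _)
  have hε₂1 : |ε₂| ≤ 1 := by rw [abs_of_nonneg hε₂0]; exact hε₂.2.trans (min_le_right _ _)
  have hz : |(0:ℝ)| ≤ 1 := by simp
  have hr0 := abs_nonneg r
  have hy0 := abs_nonneg y
  -- variation in `ε₂`
  have hA : |F (r, θ, y, ε₁, ε₂) - F (r, θ, y, ε₁, 0)| ≤ L₀ * ε₂ := by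
    refine (hlip₀ _ _ (norm_quintuple_le hr1 hθ hy1 hε₁1 hε₂1)
      (norm_quintuple_le hr1 hθ hy1 hε₁1 hz)).trans ?_
    gcongr
    apply norm_quintuple_le <;> simp [hε₂0, abs_of_nonneg]
  -- variation in `y`
  have hB : |F (r, θ, y, ε₁, 0) - F (r, θ, 0, ε₁, 0) + aCoef F θ * y| ≤
      L₁ * (|r| + |y| + ε₁) * |y| := by
    have h := abs_sub_apply_zero_le_of_abs_deriv_le (x := y) (M := L₁ * (|r| + |y| + ε₁))
      (fun t => (hasDerivAt_third_of_differentiable hFd r θ ε₁ 0 t).add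
        ((hasDerivAt_id t).const_mul (aCoef F θ))) ?_
    · convert h using 2
      simp
      ring
    · intro t ht
      rw [ha, mul_one, ← sub_eq_add_neg]
      refine (hlip₁ _ _ (norm_quintuple_le hr1 hθ (ht.trans hy1) hε₁1 hz)
        (norm_quintuple_le hz hθ hz hz hz)).trans ?_
      gcongr
      apply norm_quintuple_le <;> simp only [sub_zero, sub_self, abs_zero, abs_of_nonneg hε₁0] <;>
        linarith
  -- second order variation in `r`
  have hderiv (t : ℝ) (ht : |t| ≤ |r|) :
      |fderiv ℝ F (t, θ, 0, ε₁, 0) (1, 0, 0, 0, 0) - 2 * bCoef F θ * t| ≤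
        L₂ * (|r| + ε₁) * |t| := by
    have h := abs_sub_apply_zero_le_of_abs_deriv_le (x := t) (M := L₂ * (|r| + ε₁))
      (fun s => (hasDerivAt_fst_of_differentiable (hDr.differentiable (by norm_num)) θ 0 ε₁ 0 s).sub
        ((hasDerivAt_id s).const_mul (2 * bCoef F θ))) ?_
    · have hzero : fderiv ℝ F (0, θ, 0, ε₁, 0) (1, 0, 0, 0, 0) = 0 := by
        rw [← (hasDerivAt_fst_of_differentiable hFd θ 0 ε₁ 0 0).deriv, h1 θ ε₁ hε₁e]
      convert h using 2
      simp [hzero]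
    · intro s hs
      rw [hb, mul_one]
      refine (hlip₂ _ _ (norm_quintuple_le ((hs.trans ht).trans hr1) hθ hz hε₁1 hz)
        (norm_quintuple_le hz hθ hz hz hz)).trans ?_
      gcongr
      apply norm_quintuple_le <;> simp only [sub_zero, sub_self, abs_zero, abs_of_nonneg hε₁0] <;>
        linarith
  have hC : |F (r, θ, 0, ε₁, 0) - bCoef F θ * r ^ 2| ≤ L₂ * (|r| + ε₁) * |r| * |r| := by
    have h := abs_sub_apply_zero_le_of_abs_deriv_le (x := r) (M := L₂ * (|r| + ε₁) * |r|)
      (fun t => (hasDerivAt_fst_of_differentiable hFd θ 0 ε₁ 0 t).sub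
        ((hasDerivAt_pow 2 t).const_mul (bCoef F θ))) ?_
    · convert h using 2
      simp [h0 θ ε₁ hε₁e]
    · intro t ht
      have hMt : L₂ * (|r| + ε₁) * |t| ≤ L₂ * (|r| + ε₁) * |r| := by gcongr
      refine (le_of_eq ?_).trans ((hderiv t ht).trans hMt)
      congr 1
      norm_num
      ring
  have hsum : |F (r, θ, y, ε₁, ε₂) - (-(aCoef F θ) * y + bCoef F θ * r ^ 2)| ≤
      L₀ * ε₂ + L₁ * (|r| + |y| + ε₁) * |y| + L₂ * (|r| + ε₁) * |r| * |r| := by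
    refine le_trans (le_of_eq ?_) ((abs_add_three _ _ _).trans (add_le_add (add_le_add hA hB) hC))
    congr 1
    ring
  refine hsum.trans ?_
  rw [← sq_abs y, ← sq_abs r]
  have e₁ : 0 ≤ |r| ^ 3 + ε₁ * |r| ^ 2 := by positivity
  have e₂ : 0 ≤ |y| ^ 2 + |r| * |y| + ε₁ * |y| := by positivity
  nlinarith [mul_nonneg hL₀ e₁, mul_nonneg hL₀ e₂, mul_nonneg hL₁ e₁, mul_nonneg hL₁ hε₂0,
    mul_nonneg hL₂ e₂, mul_nonneg hL₂ hε₂0]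


theorem stmt1 (e₀ : ℝ) (he₀ : 0 < e₀)
    (F : ℝ × ℝ × ℝ × ℝ × ℝ → ℝ) (hF : ContDiff ℝ 3 F)
    (hper : ∀ r θ y ε₁ ε₂ : ℝ, F (r, θ + 1, y, ε₁, ε₂) = F (r, θ, y, ε₁, ε₂))
    (h0 : ∀ θ : ℝ, ∀ ε₁ ∈ Set.Icc (0:ℝ) e₀, F (0, θ, 0, ε₁, 0) = 0)
    (h1 : ∀ θ : ℝ, ∀ ε₁ ∈ Set.Icc (0:ℝ) e₀, deriv (fun r => F (r, θ, 0, ε₁, 0)) 0 = 0)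
    (h2 : ∀ θ : ℝ, 0 < iteratedDeriv 2 (fun r => F (r, θ, 0, 0, 0)) 0)
    (h3 : ∀ θ : ℝ, deriv (fun y => F (0, θ, y, 0, 0)) 0 < 0) :
    (∀ θ, 0 < aCoef F θ) ∧ (∀ θ, 0 < bCoef F θ) ∧
    (∀ θ, aCoef F (θ + 1) = aCoef F θ) ∧ (∀ θ, bCoef F (θ + 1) = bCoef F θ) ∧
    ContDiff ℝ 1 (aCoef F) ∧ ContDiff ℝ 1 (bCoef F) ∧
    ∃ δ > (0:ℝ), ∃ C > (0:ℝ), ∀ r y θ : ℝ, ∀ ε₁ ∈ Set.Icc (0:ℝ) δ, ∀ ε₂ ∈ Set.Icc (0:ℝ) δ,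
      |r| ≤ δ → |y| ≤ δ →
      |F (r, θ, y, ε₁, ε₂) - (-(aCoef F θ) * y + bCoef F θ * r ^ 2)| ≤
        C * (|r| ^ 3 + y ^ 2 + |r| * |y| + ε₁ * r ^ 2 + ε₁ * |y| + ε₂) := by
  have hFd : Differentiable ℝ F := hF.differentiable (by norm_num)
  have haper (θ : ℝ) : aCoef F (θ + 1) = aCoef F θ := by simp only [aCoef, hper]
  have hbper (θ : ℝ) : bCoef F (θ + 1) = bCoef F θ := by simp only [bCoef, hper]
  refine ⟨fun θ => neg_pos.2 (h3 θ), fun θ => mul_pos (by norm_num) (h2 θ), haper, hbper,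
    ?_, ?_, ?_⟩
  · have hDy : ContDiff ℝ 1 (fun p => fderiv ℝ F p (0, 0, 1, 0, 0)) :=
      (hF.fderiv_right (m := 1) (by norm_num)).clm_apply contDiff_const
    have ha : aCoef F = fun θ => -fderiv ℝ F (0, θ, 0, 0, 0) (0, 0, 1, 0, 0) :=
      funext fun θ => by rw [aCoef, (hasDerivAt_third_of_differentiable hFd 0 θ 0 0 0).deriv]
    rw [ha]
    exact (hDy.comp (by fun_prop : ContDiff ℝ 1
      (fun θ : ℝ => ((0, θ, 0, 0, 0) : ℝ × ℝ × ℝ × ℝ × ℝ)))).neg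
  · have hDrr : ContDiff ℝ 1
        (fun p => fderiv ℝ (fun p => fderiv ℝ F p (1, 0, 0, 0, 0)) p (1, 0, 0, 0, 0)) :=
      (((hF.fderiv_right (m := 2) (by norm_num)).clm_apply contDiff_const).fderiv_right
        (m := 1) (by norm_num)).clm_apply contDiff_const
    have hb : bCoef F = fun θ => (1 / 2) * fderiv ℝ (fun p => fderiv ℝ F p (1, 0, 0, 0, 0))
        (0, θ, 0, 0, 0) (1, 0, 0, 0, 0) :=
      funext fun θ => by rw [bCoef, iteratedDeriv_two_fst_eq (hF.of_le (by norm_num))]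
    rw [hb]
    exact contDiff_const.mul (hDrr.comp (by fun_prop : ContDiff ℝ 1
      (fun θ : ℝ => ((0, θ, 0, 0, 0) : ℝ × ℝ × ℝ × ℝ × ℝ))))
  · obtain ⟨δ, hδ, C, hC, hbound⟩ := exists_remainder_bound_on_unit_interval he₀ hF h0 h1
    refine ⟨δ, hδ, C, hC, fun r y θ ε₁ hε₁ ε₂ hε₂ hr hy => ?_⟩
    have hfract {f : ℝ → ℝ} (hf : Function.Periodic f 1) : f (Int.fract θ) = f θ := by
      rw [← Int.self_sub_floor, ← mul_one (⌊θ⌋ : ℝ), hf.sub_int_mul_eq]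
    have hθ : |Int.fract θ| ≤ 1 := by
      rw [abs_of_nonneg (Int.fract_nonneg θ)]
      exact (Int.fract_lt_one θ).le
    have h := hbound r y (Int.fract θ) hθ ε₁ hε₁ ε₂ hε₂ hr hy
    rwa [hfract haper, hfract hbper,
      hfract (f := fun θ => F (r, θ, y, ε₁, ε₂)) fun θ => hper r θ y ε₁ ε₂] at h
end

section
/- Let a, b, c : ℝ → ℝ be C¹ and 1-periodic, let R_r, R_y : ℝ⁴ → ℝ be C¹, let α ∈ {1,2}, and let (r,θ,y,ε) : I → ℝ⁴ be differentiable on an interval I with y(t) > 0 on I and satisfying r' = −a(θ)y + b(θ)r² + R_r(r,θ,y,ε), θ' = ε^α, y' = ε³(−c(θ) + R_y(r,θ,y,ε)), ε' = 0. Define ρ₁ := √y, r₁ := r/ρ₁, ε₁ := ε/ρ₁. Then on I: r₁' = ρ₁·(−a(θ) + b(θ)r₁² + (1/2)(c(θ) − R_y(r,θ,y,ε))·ε₁³r₁ + ρ₁⁻²·R_r(r,θ,y,ε)), θ' = ρ₁·ρ₁^(α−1)ε₁^α, ρ₁' = ρ₁·(−(1/2)ρ₁ε₁³(c(θ) − R_y(r,θ,y,ε))),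 and ε₁' = ρ₁·((1/2)ε₁⁴(c(θ) − R_y(r,θ,y,ε))); that is, each chart variable's derivative equals ρ₁ times the desingularized K₁ vector field with exact remainder terms. -/
theorem stmt3 (a b c : ℝ → ℝ)
    (ha : ContDiff ℝ 1 a) (hb : ContDiff ℝ 1 b) (hc : ContDiff ℝ 1 c)
    (hpa : ∀ ϑ : ℝ, a (ϑ + 1) = a ϑ) (hpb : ∀ ϑ : ℝ, b (ϑ + 1) = b ϑ)
    (hpc : ∀ ϑ : ℝ, c (ϑ + 1) = c ϑ)
    (Rr Ry : ℝ × ℝ × ℝ × ℝ → ℝ) (hRr : ContDiff ℝ 1 Rr) (hRy : ContDiff ℝ 1 Ry)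
    (α : ℕ) (hα : α = 1 ∨ α = 2)
    (I : Set ℝ) (r θ y ε : ℝ → ℝ)
    (hypos : ∀ t ∈ I, 0 < y t)
    (hr' : ∀ t ∈ I, HasDerivAt r
      (-(a (θ t)) * y t + b (θ t) * (r t) ^ 2 + Rr (r t, θ t, y t, ε t)) t)
    (hθ' : ∀ t ∈ I, HasDerivAt θ ((ε t) ^ α) t)
    (hy' : ∀ t ∈ I, HasDerivAt y
      ((ε t) ^ 3 * (-(c (θ t)) + Ry (r t, θ t, y t, ε t))) t)
    (hε' : ∀ t ∈ I, HasDerivAt ε 0 t) :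
    ∀ t ∈ I,
      -- r₁' = ρ₁ · ( −a(θ) + b(θ)r₁² + (1/2)(c(θ) − R_y)·ε₁³r₁ + ρ₁⁻²·R_r )
      HasDerivAt (fun s => r s / Real.sqrt (y s))
        (Real.sqrt (y t) *
          (-(a (θ t)) + b (θ t) * (r t / Real.sqrt (y t)) ^ 2
            + (1/2) * (c (θ t) - Ry (r t, θ t, y t, ε t))
                * (ε t / Real.sqrt (y t)) ^ 3 * (r t / Real.sqrt (y t))
            + ((Real.sqrt (y t)) ^ 2)⁻¹ * Rr (r t, θ t, y t, ε t))) t ∧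
      -- θ' = ρ₁ · ρ₁^(α−1) ε₁^α
      HasDerivAt θ
        (Real.sqrt (y t) *
          ((Real.sqrt (y t)) ^ (α - 1) * (ε t / Real.sqrt (y t)) ^ α)) t ∧
      -- ρ₁' = ρ₁ · ( −(1/2)ρ₁ε₁³(c(θ) − R_y) )
      HasDerivAt (fun s => Real.sqrt (y s))
        (Real.sqrt (y t) *
          (-((1/2) * Real.sqrt (y t) * (ε t / Real.sqrt (y t)) ^ 3
            * (c (θ t) - Ry (r t, θ t, y t, ε t))))) t ∧
      -- ε₁' = ρ₁ · ( (1/2)ε₁⁴(c(θ) − R_y) )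
      HasDerivAt (fun s => ε s / Real.sqrt (y s))
        (Real.sqrt (y t) *
          ((1/2) * (ε t / Real.sqrt (y t)) ^ 4
            * (c (θ t) - Ry (r t, θ t, y t, ε t)))) t := by
  intro t ht
  have hρ : 0 < Real.sqrt (y t) := Real.sqrt_pos.2 (hypos t ht)
  have hρ0 := hρ.ne'
  have hsqrt := (hy' t ht).sqrt (hypos t ht).ne'
  have hyρ : y t = Real.sqrt (y t) ^ 2 := (Real.sq_sqrt (hypos t ht).le).symm
  have hr := hr' t ht
  generalize Rr (r t, θ t, y t, ε t) = R at *
  generalize Ry (r t, θ t, y t, ε t) = S at *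
  refine ⟨?_, ?_, ?_, ?_⟩
  · refine (hr.div hsqrt hρ0).congr_deriv ?_
    generalize Real.sqrt (y t) = ρ at *
    rw [hyρ]
    field_simp
    ring
  · refine (hθ' t ht).congr_deriv ?_
    rcases hα with rfl | rfl <;> field_simp <;> simp
  · refine hsqrt.congr_deriv ?_
    field_simp
    ring
  · refine ((hε' t ht).div hsqrt hρ0).congr_deriv ?_
    field_simp
    ring
end

section
/- Let a, b, c : ℝ → ℝ be C¹ and 1-periodic, let R_r, R_y : ℝ⁴ → ℝ be C¹, let α ∈ {1,2}, and let (r,θ,y,ε) : I → ℝ⁴ be differentiable on an interval I with r(t) > 0 on I and satisfying r' = −a(θ)y + b(θ)r² + R_r(r,θ,y,ε), θ' = ε^α, y' = ε³(−c(θ) + R_y(r,θ,y,ε)), ε' = 0. Define ρ₃ := r, y₃ := y/r², ε₃ := ε/r, and F := b(θ) − a(θ)y₃ + ρ₃⁻²·R_r(r,θ,y,ε). Then on I: ρ₃' = ρ₃·(ρ₃F), θ' = ρ₃·ρ₃^(α−1)ε₃^α, y₃' = ρ₃·(−2y₃F + ε₃³(−c(θ) + R_y(r,θ,y,ε))), and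 ε₃' = ρ₃·(−ε₃F); that is, each chart variable's derivative equals ρ₃ times the desingularized K₃ vector field with exact remainder terms. -/
theorem stmt5 (a b c : ℝ → ℝ)
    (ha : ContDiff ℝ 1 a) (hb : ContDiff ℝ 1 b) (hc : ContDiff ℝ 1 c)
    (hpa : ∀ ϑ : ℝ, a (ϑ + 1) = a ϑ) (hpb : ∀ ϑ : ℝ, b (ϑ + 1) = b ϑ)
    (hpc : ∀ ϑ : ℝ, c (ϑ + 1) = c ϑ)
    (Rr Ry : ℝ × ℝ × ℝ × ℝ → ℝ) (hRr : ContDiff ℝ 1 Rr) (hRy : ContDiff ℝ 1 Ry)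
    (α : ℕ) (hα : α = 1 ∨ α = 2)
    (I : Set ℝ) (r θ y ε : ℝ → ℝ)
    (hrpos : ∀ t ∈ I, 0 < r t)
    (hr' : ∀ t ∈ I, HasDerivAt r
      (-(a (θ t)) * y t + b (θ t) * (r t) ^ 2 + Rr (r t, θ t, y t, ε t)) t)
    (hθ' : ∀ t ∈ I, HasDerivAt θ ((ε t) ^ α) t)
    (hy' : ∀ t ∈ I, HasDerivAt y
      ((ε t) ^ 3 * (-(c (θ t)) + Ry (r t, θ t, y t, ε t))) t)
    (hε' : ∀ t ∈ I, HasDerivAt ε 0 t) :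
    ∀ t ∈ I,
      -- ρ₃' = ρ₃ · (ρ₃ F)   with  F = b(θ) − a(θ)y₃ + ρ₃⁻²·R_r
      HasDerivAt r
        (r t * (r t *
          (b (θ t) - a (θ t) * (y t / (r t) ^ 2)
            + ((r t) ^ 2)⁻¹ * Rr (r t, θ t, y t, ε t)))) t ∧
      -- θ' = ρ₃ · ρ₃^(α−1) ε₃^α
      HasDerivAt θ (r t * ((r t) ^ (α - 1) * (ε t / r t) ^ α)) t ∧
      -- y₃' = ρ₃ · ( −2y₃F + ε₃³(−c(θ) + R_y) )
      HasDerivAt (fun s => y s / (r s) ^ 2)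
        (r t * (-2 * (y t / (r t) ^ 2) *
          (b (θ t) - a (θ t) * (y t / (r t) ^ 2)
            + ((r t) ^ 2)⁻¹ * Rr (r t, θ t, y t, ε t))
          + (ε t / r t) ^ 3 * (-(c (θ t)) + Ry (r t, θ t, y t, ε t)))) t ∧
      -- ε₃' = ρ₃ · ( −ε₃F )
      HasDerivAt (fun s => ε s / r s)
        (r t * (-(ε t / r t) *
          (b (θ t) - a (θ t) * (y t / (r t) ^ 2)
            + ((r t) ^ 2)⁻¹ * Rr (r t, θ t, y t, ε t)))) t := by
  intro t ht
  have hne : r t ≠ 0 := (hrpos t ht).ne'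
  have hr := hr' t ht
  refine ⟨?_, ?_, ?_, ?_⟩
  · refine hr.congr_deriv ?_
    field_simp
    ring
  · refine (hθ' t ht).congr_deriv ?_
    rcases hα with rfl | rfl <;> norm_num <;> field_simp
  · refine ((hy' t ht).fun_div (hr.fun_pow 2) (pow_ne_zero 2 hne)).congr_deriv ?_
    norm_num
    field_simp
    ring
  · refine ((hε' t ht).fun_div hr hne).congr_deriv ?_
    field_simp
    ring
end
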